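/- Let v be a real-valued function of class C² on an open subset of ℂⁿ ≅ ℝ²ⁿ and let p be a point at which the real Hessian D²v(p) (a symmetric 2n×2n real matrix) is positive semidefinite. Then det(D²v(p)) ≤ 2²ⁿ (det(v_{i\bar j}(p)))², where (v_{i\bar j}(p)) denotes the (Hermitian, positive semidefinite) complex Hessian matrix with entries v_{i\bar j} = ∂²v/∂zᵢ∂z̄ⱼ. -/

import Mathlib

/-- The complex Hessian entry `∂²v/∂zᵢ∂z̄ⱼ(z)` of a real-valued function `v` on `ℂⁿ`,
computed from real second directional derivatives:
`∂²v/∂zᵢ∂z̄ⱼ = ¼[(v_{xᵢxⱼ} + v_{yᵢyⱼ}) + √−1 (v_{xᵢyⱼ} − v_{yᵢxⱼ})]`. -/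
noncomputable def cplxHessianEntry (n : ℕ) (v : (Fin n → ℂ) → ℝ) (z : Fin n → ℂ)
    (i j : Fin n) : ℂ :=
  (1 / 4 : ℂ) *
    (((fderiv ℝ (fun w => fderiv ℝ v w (Pi.single i 1)) z (Pi.single j 1) +
        fderiv ℝ (fun w => fderiv ℝ v w (Pi.single i Complex.I)) z
          (Pi.single j Complex.I) : ℝ) : ℂ) +
      Complex.I *
        ((fderiv ℝ (fun w => fderiv ℝ v w (Pi.single i 1)) z (Pi.single j Complex.I) -
          fderiv ℝ (fun w => fderiv ℝ v w (Pi.single i Complex.I)) z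
            (Pi.single j 1) : ℝ) : ℂ))

/-- The complex Hessian matrix `(v_{i\bar j}(z))` of `v : ℂⁿ → ℝ` at `z`. -/
noncomputable def cplxHessian (n : ℕ) (v : (Fin n → ℂ) → ℝ) (z : Fin n → ℂ) :
    Matrix (Fin n) (Fin n) ℂ :=
  Matrix.of fun i j => cplxHessianEntry n v z i j

/-- The real Hessian matrix `D²v(p)` of `v : ℂⁿ ≅ ℝ²ⁿ → ℝ`, a `2n × 2n` real matrix indexed
by `Fin n ⊕ Fin n`: the first block of indices corresponds to the directions `xᵢ`
(`Pi.single i 1`) and the second to `yᵢ` (`Pi.single i √−1`). -/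
noncomputable def realHessian (n : ℕ) (v : (Fin n → ℂ) → ℝ) (p : Fin n → ℂ) :
    Matrix (Fin n ⊕ Fin n) (Fin n ⊕ Fin n) ℝ :=
  Matrix.of fun a b =>
    fderiv ℝ (fun w => fderiv ℝ v w
        (Sum.elim (fun i : Fin n => Pi.single i (1 : ℂ))
          (fun i : Fin n => Pi.single i Complex.I) a)) p
      (Sum.elim (fun i : Fin n => Pi.single i (1 : ℂ))
        (fun i : Fin n => Pi.single i Complex.I) b)

section

open Matrix
open scoped ComplexOrder

/-- `det (1 + A) ≥ 1` for a positive semidefinite matrix `A`. -/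
theorem Matrix.PosSemidef.one_le_det_one_add {m : Type*} [Fintype m] [DecidableEq m]
    {A : Matrix m m ℂ} (hA : A.PosSemidef) : 1 ≤ (1 + A).det := by
  have hdet : (1 + A).det = ∏ i, (1 + (hA.1.eigenvalues i : ℂ)) := by
    have h := congrArg (Polynomial.eval (-1)) hA.1.charpoly_eq
    rw [Matrix.eval_charpoly, Polynomial.eval_prod] at h
    have h₁ : (scalar m (-1 : ℂ)) - A = -(1 + A) := by
      rw [map_neg, map_one]
      abel
    rw [h₁, det_neg] at h
    have h₂ : ∀ i, Polynomial.eval (-1) (Polynomial.X - Polynomial.C (hA.1.eigenvalues i : ℂ)) =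
        (-1) * (1 + (hA.1.eigenvalues i : ℂ)) := fun i => by
      simp
      ring
    simp only [Complex.coe_algebraMap, h₂, Finset.prod_mul_distrib, Finset.prod_const,
      Finset.card_univ] at h
    exact mul_left_cancel₀ (pow_ne_zero _ (by norm_num)) h
  have hprod : (1 : ℝ) ≤ ∏ i, (1 + hA.1.eigenvalues i) :=
    Finset.one_le_prod fun i _ => le_add_of_nonneg_right (hA.eigenvalues_nonneg i)
  rw [hdet]
  exact_mod_cast hprod

open scoped MatrixOrder in
/-- The determinant is monotone on positive semidefinite matrices. -/
theorem Matrix.PosSemidef.det_le_det_add {m : Type*} [Fintype m] [DecidableEq m]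
    {A B : Matrix m m ℂ} (hA : A.PosSemidef) (hB : B.PosSemidef) : A.det ≤ (A + B).det := by
  by_cases h0 : A.det = 0
  · rw [h0]
    exact (hA.add hB).det_nonneg
  obtain ⟨S, hS⟩ := CStarAlgebra.nonneg_iff_eq_star_mul_self.mp hA.nonneg
  rw [star_eq_conjTranspose] at hS
  have hSu : IsUnit S.det := by
    refine isUnit_iff_ne_zero.mpr fun h => h0 ?_
    rw [hS, det_mul, h, mul_zero]
  have hW := hB.conjTranspose_mul_mul_same S⁻¹
  have hAB : A + B = Sᴴ * (1 + S⁻¹ᴴ * B * S⁻¹) * S := by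
    have h₁ : Sᴴ * S⁻¹ᴴ = 1 := by
      rw [← conjTranspose_mul, nonsing_inv_mul _ hSu, conjTranspose_one]
    calc A + B = Sᴴ * S + (Sᴴ * S⁻¹ᴴ) * B * (S⁻¹ * S) := by
          rw [← hS, h₁, nonsing_inv_mul _ hSu, Matrix.one_mul, Matrix.mul_one]
      _ = _ := by simp only [Matrix.mul_add, Matrix.add_mul, Matrix.mul_one, Matrix.mul_assoc]
  have hdet : (A + B).det = A.det * (1 + S⁻¹ᴴ * B * S⁻¹).det := by
    rw [hAB, hS]
    simp only [det_mul]
    ring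
  rw [hdet]
  exact le_mul_of_one_le_right hA.det_nonneg hW.one_le_det_one_add

/-- **Fischer's inequality**: the determinant of a positive semidefinite block matrix is at most
the product of the determinants of its diagonal blocks. -/
theorem Matrix.PosSemidef.det_fromBlocks_le {m k : Type*} [Fintype m] [DecidableEq m]
    [Fintype k] [DecidableEq k] {A : Matrix m m ℂ} {B : Matrix m k ℂ} {C : Matrix k m ℂ}
    {D : Matrix k k ℂ} (hM : (fromBlocks A B C D).PosSemidef) :
    (fromBlocks A B C D).det ≤ A.det * D.det := by
  have hA : A.PosSemidef := hM.submatrix Sum.inl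
  have hD : D.PosSemidef := hM.submatrix Sum.inr
  by_cases h0 : (fromBlocks A B C D).det = 0
  · rw [h0]
    exact mul_nonneg hA.det_nonneg hD.det_nonneg
  obtain rfl : Bᴴ = C := (isHermitian_fromBlocks_iff.mp hM.1).2.1
  have hA' : A.PosDef := (hM.posDef_iff_det_ne_zero.mpr h0).submatrix Sum.inl_injective
  let : Invertible A := hA'.isUnit.invertible
  have hS : (D - Bᴴ * A⁻¹ * B).PosSemidef := (hA'.fromBlocks₁₁ B D).mp hM
  have hle := hS.det_le_det_add (hA.inv.conjTranspose_mul_mul_same B)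
  rw [sub_add_cancel] at hle
  rw [det_fromBlocks₁₁, invOf_eq_nonsing_inv]
  exact mul_le_mul_of_nonneg_left hle hA.det_nonneg

open scoped MatrixOrder in
/-- A real positive semidefinite matrix remains positive semidefinite over `ℂ`. -/
theorem Matrix.PosSemidef.map_ofReal {m : Type*} [Fintype m] {A : Matrix m m ℝ}
    (hA : A.PosSemidef) : (A.map Complex.ofReal).PosSemidef := by
  classical
  obtain ⟨S, rfl⟩ := CStarAlgebra.nonneg_iff_eq_star_mul_self.mp hA.nonneg
  have h : (star S * S).map Complex.ofReal = (S.map Complex.ofReal)ᴴ * S.map Complex.ofReal := by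
    ext i j
    simp [star_eq_conjTranspose, mul_apply]
  rw [h]
  exact posSemidef_conjTranspose_mul_self _

/-- For a positive semidefinite real block matrix with blocks `A, B, C, D`, the determinant is
controlled by that of its `J`-invariant part `(A + D) + √−1 (B - C)`. -/
theorem Matrix.PosSemidef.det_fromBlocks_le_normSq {m : Type*} [Fintype m] [DecidableEq m]
    {A B C D : Matrix m m ℝ} (hM : (fromBlocks A B C D).PosSemidef) :
    2 ^ (2 * Fintype.card m) * (fromBlocks A B C D).det ≤
      Complex.normSq ((A + D).map Complex.ofReal + Complex.I • (B - C).map Complex.ofReal).det := by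
  set P : Matrix m m ℂ := (A + D).map Complex.ofReal + Complex.I • (B - C).map Complex.ofReal
    with hP
  let T : Matrix (m ⊕ m) (m ⊕ m) ℂ :=
    fromBlocks 1 1 (Complex.I • 1) (-(Complex.I • 1))
  have hTT : Tᴴ * T = (2 : ℂ) • 1 := by
    simp only [T, fromBlocks_conjTranspose, fromBlocks_multiply, ← fromBlocks_one,
      fromBlocks_smul]
    congr 1 <;> simp [smul_smul, two_smul]
  obtain ⟨Q, R, hTMT⟩ : ∃ Q R, Tᴴ * (fromBlocks A B C D).map Complex.ofReal * T =
      fromBlocks P Q R (P.map (starRingEnd ℂ)) := by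
    refine ⟨(Tᴴ * (fromBlocks A B C D).map Complex.ofReal * T).toBlocks₁₂,
      (Tᴴ * (fromBlocks A B C D).map Complex.ofReal * T).toBlocks₂₁, ?_⟩
    simp only [T, fromBlocks_conjTranspose, fromBlocks_map, fromBlocks_multiply,
      toBlocks_fromBlocks₁₂, toBlocks_fromBlocks₂₁]
    congr 1
    · ext i j
      simp [hP]
      linear_combination (-(D i j : ℂ)) * Complex.I_sq
    · ext i j
      simp [hP]
      linear_combination (-(D i j : ℂ)) * Complex.I_sq
  have hpsd := hM.map_ofReal.conjTranspose_mul_mul_same T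
  rw [hTMT] at hpsd
  have hle := hpsd.det_fromBlocks_le
  have hdet : (fromBlocks P Q R (P.map (starRingEnd ℂ))).det =
      2 ^ (2 * Fintype.card m) * ((fromBlocks A B C D).det : ℂ) := by
    have hmap : ((fromBlocks A B C D).map Complex.ofReal).det = ((fromBlocks A B C D).det : ℂ) :=
      (RingHom.map_det Complex.ofRealHom _).symm
    have hT := congrArg det hTT
    rw [det_mul, det_smul, det_one, mul_one, Fintype.card_sum, ← two_mul] at hT
    rw [← hTMT, det_mul, det_mul, hmap, ← hT]
    ring
  have hconj : (P.map (starRingEnd ℂ)).det = starRingEnd ℂ P.det :=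
    (RingHom.map_det (starRingEnd ℂ) P).symm
  rw [hdet, hconj, Complex.mul_conj] at hle
  exact_mod_cast hle

end

/-- Błocki's inequality. Let `v` be `C²` on an open subset of `ℂⁿ` and
let `p` be a point at which the real Hessian `D²v(p)` is positive semidefinite.  Then
`det(D²v(p)) ≤ 2^{2n} (det(v_{i\bar j}(p)))²` (the complex Hessian determinant being a
nonnegative real number, we take its real part). -/
theorem stmt_12 (n : ℕ) (v : (Fin n → ℂ) → ℝ) (U : Set (Fin n → ℂ)) (hU : IsOpen U)
    (p : Fin n → ℂ) (hp : p ∈ U) (hv : ContDiffOn ℝ 2 v U)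
    (hpsd : (realHessian n v p).PosSemidef) :
    (realHessian n v p).det ≤ 2 ^ (2 * n) * ((cplxHessian n v p).det.re) ^ 2 := by
  have hblocks := Matrix.fromBlocks_toBlocks (realHessian n v p)
  have hle := (hblocks.symm ▸ hpsd).det_fromBlocks_le_normSq
  rw [hblocks, Fintype.card_fin] at hle
  set H := realHessian n v p with hH
  have hC : (H.toBlocks₁₁ + H.toBlocks₂₂).map Complex.ofReal +
      Complex.I • (H.toBlocks₁₂ - H.toBlocks₂₁).map Complex.ofReal =
      (4 : ℂ) • cplxHessian n v p := by
    ext i j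
    simp [hH, realHessian, cplxHessian, cplxHessianEntry, Matrix.toBlocks₁₁, Matrix.toBlocks₁₂,
      Matrix.toBlocks₂₁, Matrix.toBlocks₂₂]
  have hherm : (cplxHessian n v p).IsHermitian := by
    have hsymm : ∀ a b, H a b = H b a := fun a b => by simpa using hpsd.1.apply b a
    ext i j
    have h₁ := hsymm (.inl i) (.inl j)
    have h₂ := hsymm (.inl i) (.inr j)
    have h₃ := hsymm (.inr i) (.inl j)
    have h₄ := hsymm (.inr i) (.inr j)
    simp only [hH, realHessian, Matrix.of_apply, Sum.elim_inl, Sum.elim_inr] at h₁ h₂ h₃ h₄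
    simp [cplxHessian, cplxHessianEntry, h₁, h₂, h₃, h₄]
    ring
  have him : (cplxHessian n v p).det.im = 0 := by
    rw [← Complex.conj_eq_iff_im]
    have h := Matrix.det_conjTranspose (cplxHessian n v p)
    rw [hherm.eq] at h
    exact h.symm
  rw [hC, Matrix.det_smul, Fintype.card_fin, map_mul, map_pow,
    Complex.normSq_apply (Matrix.det _), him] at hle
  have h4 : Complex.normSq 4 ^ n = 2 ^ (2 * n) * 2 ^ (2 * n) := by
    rw [pow_mul, ← mul_pow]
    norm_num [Complex.normSq_apply]
  rw [h4] at hle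
  have hpos : (0 : ℝ) < 2 ^ (2 * n) := by positivity
  refine le_of_mul_le_mul_left (hle.trans_eq ?_) hpos
  ring
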